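/- arXiv:2510.23531 — 2 statements merged into one kernel-verified Lean document; each statement's English description precedes it below -/
import Mathlib

section
/- Let E and B be small categories and p : E ⥤ B a discrete opfibration. Then there exist a functor F : B ⥤ Type u and an isomorphism of categories Φ : E ≅ F.Elements such that Φ composed with the projection π : F.Elements ⥤ B equals p. (Concretely one may take F to be the functor of fibers, F.obj b = { e : E // p.obj e = b } with action given by the unique lifts.) -/
open CategoryTheory

universe u

/-- A functor `p : E ⥤ B` is a discrete opfibration if every morphism
`φ : p.obj e ⟶ b` admits a unique lift. -/
def IsDiscreteOpfibration {E B : Type*} [Category E] [Category B] (p : E ⥤ B) : Prop :=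
  ∀ ⦃e : E⦄ ⦃b : B⦄ (φ : p.obj e ⟶ b),
    ∃! ψ : Σ e' : E, e ⟶ e', ∃ h : p.obj ψ.1 = b, p.map ψ.2 ≫ eqToHom h = φ

namespace IsDiscreteOpfibration

variable {E B : Type u} [SmallCategory E] [SmallCategory B] {p : E ⥤ B}

theorem existsUnique_lift (hp : IsDiscreteOpfibration p) {b b' : B} (f : b ⟶ b')
    (x : {e : E // p.obj e = b}) :
    ∃! ψ : Σ y : {e : E // p.obj e = b'}, x.1 ⟶ y.1,
      p.map ψ.2 ≫ eqToHom ψ.1.2 = eqToHom x.2 ≫ f := by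
  obtain ⟨⟨e', g⟩, ⟨h, hg⟩, hu⟩ := hp (eqToHom x.2 ≫ f)
  refine ⟨⟨⟨e', h⟩, g⟩, hg, ?_⟩
  rintro ⟨⟨e'', h''⟩, g''⟩ hg''
  cases hu ⟨e'', g''⟩ ⟨h'', hg''⟩
  rfl

/-- The transport of a point of a fiber along a morphism of the base. -/
noncomputable def transport (hp : IsDiscreteOpfibration p) {b b' : B} (f : b ⟶ b')
    (x : {e : E // p.obj e = b}) : {e : E // p.obj e = b'} :=
  (hp.existsUnique_lift f x).choose.1

theorem transport_eq_iff (hp : IsDiscreteOpfibration p) {b b' : B} (f : b ⟶ b')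
    (x : {e : E // p.obj e = b}) (y : {e : E // p.obj e = b'}) :
    hp.transport f x = y ↔ ∃ g : x.1 ⟶ y.1, p.map g ≫ eqToHom y.2 = eqToHom x.2 ≫ f := by
  constructor
  · rintro rfl
    exact ⟨_, (hp.existsUnique_lift f x).choose_spec.1⟩
  · rintro ⟨g, hg⟩
    exact congrArg Sigma.fst ((hp.existsUnique_lift f x).choose_spec.2 ⟨y, g⟩ hg).symm

theorem map_injective (hp : IsDiscreteOpfibration p) {e e' : E} {g g' : e ⟶ e'}
    (h : p.map g = p.map g') : g = g' := by
  have := (hp (p.map g)).unique (y₁ := ⟨e', g⟩) (y₂ := ⟨e', g'⟩)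
    ⟨rfl, by simp⟩ ⟨rfl, by simp [h]⟩
  simpa using this

theorem transport_id (hp : IsDiscreteOpfibration p) {b : B} (x : {e : E // p.obj e = b}) :
    hp.transport (𝟙 b) x = x :=
  (hp.transport_eq_iff _ _ _).2 ⟨𝟙 _, by simp⟩

theorem transport_comp (hp : IsDiscreteOpfibration p) {a b c : B} (f : a ⟶ b) (f' : b ⟶ c)
    (x : {e : E // p.obj e = a}) :
    hp.transport (f ≫ f') x = hp.transport f' (hp.transport f x) := by
  obtain ⟨g, hg⟩ := (hp.transport_eq_iff f x _).1 rfl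
  obtain ⟨g', hg'⟩ := (hp.transport_eq_iff f' (hp.transport f x) _).1 rfl
  exact (hp.transport_eq_iff _ _ _).2 ⟨g ≫ g', by
    rw [p.map_comp, Category.assoc, hg', reassoc_of% hg]⟩

/-- The functor of fibers of a discrete opfibration. -/
noncomputable def fibers (hp : IsDiscreteOpfibration p) : B ⥤ Type u where
  obj b := {e : E // p.obj e = b}
  map f := ↾(hp.transport f)
  map_id _ := ConcreteCategory.hom_ext _ _ hp.transport_id
  map_comp f f' := ConcreteCategory.hom_ext _ _ (hp.transport_comp f f')

/-- The comparison functor to the category of elements of the functor of fibers. -/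
noncomputable def toElements (hp : IsDiscreteOpfibration p) : E ⥤ hp.fibers.Elements where
  obj e := ⟨p.obj e, ⟨e, rfl⟩⟩
  map {e e'} g := ⟨p.map g, (hp.transport_eq_iff (p.map g) ⟨e, rfl⟩ ⟨e', rfl⟩).2 ⟨g, by simp⟩⟩

theorem exists_map_eq (hp : IsDiscreteOpfibration p) {x y : hp.fibers.Elements} (f : x ⟶ y) :
    ∃ g : x.2.1 ⟶ y.2.1, p.map g ≫ eqToHom y.2.2 = eqToHom x.2.2 ≫ f.1 :=
  (hp.transport_eq_iff f.1 x.2 y.2).1 f.2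

/-- The lift to the total category of a morphism of elements of the functor of fibers. -/
noncomputable def lift (hp : IsDiscreteOpfibration p) {x y : hp.fibers.Elements} (f : x ⟶ y) :
    x.2.1 ⟶ y.2.1 :=
  (hp.exists_map_eq f).choose

theorem map_lift (hp : IsDiscreteOpfibration p) {x y : hp.fibers.Elements} (f : x ⟶ y) :
    p.map (hp.lift f) ≫ eqToHom y.2.2 = eqToHom x.2.2 ≫ f.1 :=
  (hp.exists_map_eq f).choose_spec

theorem lift_eq (hp : IsDiscreteOpfibration p) {x y : hp.fibers.Elements} (f : x ⟶ y)
    (g : x.2.1 ⟶ y.2.1) (hg : p.map g ≫ eqToHom y.2.2 = eqToHom x.2.2 ≫ f.1) :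
    hp.lift f = g :=
  hp.map_injective ((cancel_mono (eqToHom y.2.2)).1 ((hp.map_lift f).trans hg.symm))

/-- The inverse of the comparison functor. -/
noncomputable def ofElements (hp : IsDiscreteOpfibration p) : hp.fibers.Elements ⥤ E where
  obj x := x.2.1
  map f := hp.lift f
  map_id x := hp.lift_eq _ _ (by simp)
  map_comp f g := hp.lift_eq _ _ (by
    rw [p.map_comp, Category.assoc, hp.map_lift, reassoc_of% (hp.map_lift f)]
    rfl)

theorem toElements_comp_ofElements (hp : IsDiscreteOpfibration p) :
    hp.toElements ⋙ hp.ofElements = 𝟭 E :=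
  CategoryTheory.Functor.hext (fun _ => rfl) fun _ _ g => heq_of_eq <|
    hp.lift_eq (hp.toElements.map g) g
      ((Category.comp_id (p.map g)).trans (Category.id_comp (p.map g)).symm)

theorem ofElements_comp_toElements (hp : IsDiscreteOpfibration p) :
    hp.ofElements ⋙ hp.toElements = 𝟭 hp.fibers.Elements := by
  refine CategoryTheory.Functor.hext ?_ ?_
  · rintro ⟨b, ⟨e, rfl⟩⟩
    rfl
  · rintro ⟨b, ⟨e, rfl⟩⟩ ⟨b', ⟨e', rfl⟩⟩ f
    have h := hp.map_lift f
    simp only [eqToHom_refl, Category.comp_id, Category.id_comp] at h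
    exact heq_of_eq (CategoryOfElements.ext _ _ _ h)

end IsDiscreteOpfibration

/-- Every discrete opfibration between small categories is, up to isomorphism of categories
over the base, the projection from the category of elements of a functor to types. -/
theorem discreteOpfibration_is_elements {E B : Type u} [SmallCategory E] [SmallCategory B]
    (p : E ⥤ B) (hp : IsDiscreteOpfibration p) :
    ∃ (F : B ⥤ Type u) (Φ : E ⥤ F.Elements) (Ψ : F.Elements ⥤ E),
      Φ ⋙ Ψ = 𝟭 E ∧ Ψ ⋙ Φ = 𝟭 F.Elements ∧ Φ ⋙ CategoryOfElements.π F = p :=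
  ⟨hp.fibers, hp.toElements, hp.ofElements, hp.toElements_comp_ofElements,
    hp.ofElements_comp_toElements, rfl⟩
end

section
/- Let C be a category with finite coproducts and pullbacks. Then C is finitary extensive if and only if for all objects y₁, y₂ of C the canonical functor Over y₁ × Over y₂ ⥤ Over (y₁ ⨿ y₂), sending a pair of objects (f : X ⟶ y₁, g : Y ⟶ y₂) to the coproduct map f ⨿ g : X ⨿ Y ⟶ y₁ ⨿ y₂, is an equivalence of categories. -/
open CategoryTheory CategoryTheory.Limits

universe v u

variable {C : Type u} [Category.{v} C] [HasFiniteCoproducts C] [HasPullbacks C]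

/-- The canonical functor `Over y₁ × Over y₂ ⥤ Over (y₁ ⨿ y₂)` sending a pair `(f, g)` to the
coproduct map `f ⨿ g`. -/
noncomputable def overCoprodFunctor (y₁ y₂ : C) : Over y₁ × Over y₂ ⥤ Over (y₁ ⨿ y₂) where
  obj fg := Over.mk (coprod.map fg.1.hom fg.2.hom)
  map {fg fg'} ab := Over.homMk (coprod.map ab.1.left ab.2.left) (by
    simp [coprod.map_map])
  map_id fg := by
    apply CostructuredArrow.hom_ext
    simp
  map_comp f g := by
    apply CostructuredArrow.hom_ext
    simp [coprod.map_map]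

section FullyFaithful

variable {y₁ y₂ : C}

omit [HasPullbacks C] in
theorem isPullback_coprod_inl_of_fullyFaithful [(overCoprodFunctor y₁ y₂).Full]
    [(overCoprodFunctor y₁ y₂).Faithful] {X Y : C} (f : X ⟶ y₁) (g : Y ⟶ y₂) :
    IsPullback coprod.inl f (coprod.map f g) coprod.inl := by
  refine ⟨⟨by simp⟩, ⟨PullbackCone.isLimitAux' _ fun s => ?_⟩⟩
  let T : Over y₁ × Over y₂ := (Over.mk s.snd, Over.mk (initial.to y₂))
  let S : Over y₁ × Over y₂ := (Over.mk f, Over.mk g)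
  let h : (overCoprodFunctor y₁ y₂).obj T ⟶ (overCoprodFunctor y₁ y₂).obj S :=
    Over.homMk (coprod.desc s.fst (initial.to _)) (by
      apply coprod.hom_ext
      · exact (coprod.inl_desc_assoc _ _ _).trans (s.condition.trans (coprod.inl_map _ _).symm)
      · exact initialIsInitial.hom_ext _ _)
  let k := (overCoprodFunctor y₁ y₂).preimage h
  have hk : (overCoprodFunctor y₁ y₂).map k = h := (overCoprodFunctor y₁ y₂).map_preimage h
  have hk' : coprod.map k.1.left k.2.left = coprod.desc s.fst (initial.to _) :=
    congrArg CommaMorphism.left hk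
  refine ⟨k.1.left, ?_, Over.w k.1, fun {m} hm₁ hm₂ => ?_⟩
  · exact (coprod.inl_map _ _).symm.trans ((coprod.inl ≫= hk').trans (coprod.inl_desc _ _))
  · let k' : T ⟶ S := (Over.homMk m hm₂, k.2)
    have hkk' : k' = k := (overCoprodFunctor y₁ y₂).map_injective (by
      rw [hk]
      apply CostructuredArrow.hom_ext
      apply coprod.hom_ext
      · exact (coprod.inl_map _ _).trans (hm₁.trans (coprod.inl_desc _ _).symm)
      · exact initialIsInitial.hom_ext _ _)
    exact congrArg (fun l => l.1.left) hkk'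

omit [HasPullbacks C] in
theorem isPullback_coprod_inr_of_fullyFaithful [(overCoprodFunctor y₁ y₂).Full]
    [(overCoprodFunctor y₁ y₂).Faithful] {X Y : C} (f : X ⟶ y₁) (g : Y ⟶ y₂) :
    IsPullback coprod.inr g (coprod.map f g) coprod.inr := by
  refine ⟨⟨by simp⟩, ⟨PullbackCone.isLimitAux' _ fun s => ?_⟩⟩
  let T : Over y₁ × Over y₂ := (Over.mk (initial.to y₁), Over.mk s.snd)
  let S : Over y₁ × Over y₂ := (Over.mk f, Over.mk g)
  let h : (overCoprodFunctor y₁ y₂).obj T ⟶ (overCoprodFunctor y₁ y₂).obj S :=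
    Over.homMk (coprod.desc (initial.to _) s.fst) (by
      apply coprod.hom_ext
      · exact initialIsInitial.hom_ext _ _
      · exact (coprod.inr_desc_assoc _ _ _).trans (s.condition.trans (coprod.inr_map _ _).symm))
  let k := (overCoprodFunctor y₁ y₂).preimage h
  have hk : (overCoprodFunctor y₁ y₂).map k = h := (overCoprodFunctor y₁ y₂).map_preimage h
  have hk' : coprod.map k.1.left k.2.left = coprod.desc (initial.to _) s.fst :=
    congrArg CommaMorphism.left hk
  refine ⟨k.2.left, ?_, Over.w k.2, fun {m} hm₁ hm₂ => ?_⟩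
  · exact (coprod.inr_map _ _).symm.trans ((coprod.inr ≫= hk').trans (coprod.inr_desc _ _))
  · let k' : T ⟶ S := (k.1, Over.homMk m hm₂)
    have hkk' : k' = k := (overCoprodFunctor y₁ y₂).map_injective (by
      rw [hk]
      apply CostructuredArrow.hom_ext
      apply coprod.hom_ext
      · exact initialIsInitial.hom_ext _ _
      · exact (coprod.inr_map _ _).trans (hm₁.trans (coprod.inr_desc _ _).symm))
    exact congrArg (fun l => l.2.left) hkk'

end FullyFaithful

theorem isVanKampenColimit_coprod_of_isEquivalence (y₁ y₂ : C)
    [(overCoprodFunctor y₁ y₂).IsEquivalence] :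
    IsVanKampenColimit (BinaryCofan.mk (coprod.inl : y₁ ⟶ y₁ ⨿ y₂) coprod.inr) := by
  refine BinaryCofan.isVanKampen_mk _ _ (fun X Y => coprodIsCoprod X Y) _
    (fun f g => pullbackIsPullback f g) ?_ ?_
  · intro X' Y' f g h hf hg
    obtain rfl : h = coprod.map f g := by
      apply coprod.hom_ext
      · exact hf.symm.trans (coprod.inl_map _ _).symm
      · exact hg.symm.trans (coprod.inr_map _ _).symm
    exact ⟨isPullback_coprod_inl_of_fullyFaithful f g, isPullback_coprod_inr_of_fullyFaithful f g⟩
  · intro Z f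
    let P := (overCoprodFunctor y₁ y₂).objPreimage (Over.mk f)
    let e : P.1.left ⨿ P.2.left ≅ Z :=
      (Over.forget _).mapIso ((overCoprodFunctor y₁ y₂).objObjPreimageIso (Over.mk f))
    have he : e.hom ≫ f = coprod.map P.1.hom P.2.hom :=
      Over.w ((overCoprodFunctor y₁ y₂).objObjPreimageIso (Over.mk f)).hom
    have hl : IsPullback (coprod.inl ≫ e.hom) P.1.hom f coprod.inl :=
      (isPullback_coprod_inl_of_fullyFaithful P.1.hom P.2.hom).of_iso (Iso.refl _) e (Iso.refl _)
        (Iso.refl _) (by simp) (by simp)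
        ((Category.comp_id _).trans he.symm) ((Category.comp_id _).trans (Category.id_comp _).symm)
    have hr : IsPullback (coprod.inr ≫ e.hom) P.2.hom f coprod.inr :=
      (isPullback_coprod_inr_of_fullyFaithful P.1.hom P.2.hom).of_iso (Iso.refl _) e (Iso.refl _)
        (Iso.refl _) (by simp) (by simp)
        ((Category.comp_id _).trans he.symm) ((Category.comp_id _).trans (Category.id_comp _).symm)
    have hc : IsColimit (BinaryCofan.mk (coprod.inl ≫ e.hom) (coprod.inr ≫ e.hom)) :=
      (coprodIsCoprod P.1.left P.2.left).ofIsoColimit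
        (Cocone.ext e (by rintro ⟨⟨⟩⟩ <;> rfl))
    have hc' := BinaryCofan.isColimitCompRightIso _ hr.isoPullback.inv
      (BinaryCofan.isColimitCompLeftIso _ hl.isoPullback.inv hc)
    exact hc'.ofIsoColimit (Cocone.ext (Iso.refl _) (by
      rintro ⟨⟨⟩⟩
      · exact (Category.comp_id _).trans hl.isoPullback_inv_fst
      · exact (Category.comp_id _).trans hr.isoPullback_inv_fst))

set_option linter.unusedSectionVars false in
theorem overCoprodFunctor_isEquivalence [FinitaryExtensive C] (y₁ y₂ : C) :
    (overCoprodFunctor y₁ y₂).IsEquivalence := by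
  have H {X Y : C} := (BinaryCofan.isVanKampen_iff _).mp
    (FinitaryExtensive.vanKampen _ (coprodIsCoprod y₁ y₂)) (X' := X) (Y' := Y)
  refine { faithful := ⟨?_⟩, full := ⟨?_⟩, essSurj := ⟨?_⟩ }
  · intro P Q a b hab
    have hab' : coprod.map a.1.left a.2.left = coprod.map b.1.left b.2.left :=
      congrArg CommaMorphism.left hab
    refine Prod.ext (Over.OverMorphism.ext ?_) (Over.OverMorphism.ext ?_)
    · rw [← cancel_mono (coprod.inl : Q.1.left ⟶ Q.1.left ⨿ Q.2.left)]
      simpa using coprod.inl ≫= hab'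
    · rw [← cancel_mono (coprod.inr : Q.2.left ⟶ Q.1.left ⨿ Q.2.left)]
      simpa using coprod.inr ≫= hab'
  · intro P Q h
    obtain ⟨hl, hr⟩ := (H (BinaryCofan.mk coprod.inl coprod.inr) Q.1.hom Q.2.hom
      (coprod.map Q.1.hom Q.2.hom) (coprod.inl_map _ _).symm
      (coprod.inr_map _ _).symm).mp ⟨coprodIsCoprod _ _⟩
    let φ : P.1.left ⨿ P.2.left ⟶ Q.1.left ⨿ Q.2.left := h.left
    have hφ : φ ≫ coprod.map Q.1.hom Q.2.hom = coprod.map P.1.hom P.2.hom := Over.w h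
    have hφl : (coprod.inl ≫ φ) ≫ coprod.map Q.1.hom Q.2.hom = P.1.hom ≫ coprod.inl := by
      simp [hφ]
    have hφr : (coprod.inr ≫ φ) ≫ coprod.map Q.1.hom Q.2.hom = P.2.hom ≫ coprod.inr := by
      simp [hφ]
    refine ⟨(Over.homMk (hl.lift _ _ hφl) (hl.lift_snd _ _ hφl),
      Over.homMk (hr.lift _ _ hφr) (hr.lift_snd _ _ hφr)), ?_⟩
    apply CostructuredArrow.hom_ext
    apply coprod.hom_ext
    · exact (coprod.inl_map _ _).trans (hl.lift_fst _ _ hφl)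
    · exact (coprod.inr_map _ _).trans (hr.lift_fst _ _ hφr)
  · intro Z
    obtain ⟨hc⟩ := (H (BinaryCofan.mk (pullback.fst Z.hom coprod.inl)
      (pullback.fst Z.hom coprod.inr)) (pullback.snd _ _) (pullback.snd _ _) Z.hom
      pullback.condition.symm pullback.condition.symm).mpr
      ⟨IsPullback.of_hasPullback _ _, IsPullback.of_hasPullback _ _⟩
    refine ⟨(Over.mk (pullback.snd Z.hom coprod.inl), Over.mk (pullback.snd Z.hom coprod.inr)),
      ⟨Over.isoMk ((coprodIsCoprod _ _).coconePointUniqueUpToIso hc) ?_⟩⟩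
    apply coprod.hom_ext
    · exact ((coprodIsCoprod _ _).comp_coconePointUniqueUpToIso_hom_assoc hc ⟨.left⟩ Z.hom).trans
        (pullback.condition.trans (coprod.inl_map _ _).symm)
    · exact ((coprodIsCoprod _ _).comp_coconePointUniqueUpToIso_hom_assoc hc ⟨.right⟩ Z.hom).trans
        (pullback.condition.trans (coprod.inr_map _ _).symm)

/-- A category with finite coproducts and pullbacks is finitary extensive if and only if for all
`y₁ y₂` the canonical functor `Over y₁ × Over y₂ ⥤ Over (y₁ ⨿ y₂)` is an equivalence. -/
theorem finitaryExtensive_iff_overCoprodFunctor_isEquivalence :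
    FinitaryExtensive C ↔ ∀ y₁ y₂ : C, (overCoprodFunctor y₁ y₂).IsEquivalence := by
  refine ⟨fun _ => overCoprodFunctor_isEquivalence, fun H => ⟨fun {X Y} c hc => ?_⟩⟩
  have := H X Y
  exact (isVanKampenColimit_coprod_of_isEquivalence X Y).of_iso
    ((coprodIsCoprod X Y).uniqueUpToIso hc)
end
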